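/- Let n ≥ 4 and d = n+3. For every triple of nonnegative integers (u,v,w) with u+v+w = n+1 and u ≥ 3 or w ≥ 3, the couple (Σ_{2,n,2},(u,v,w)) is not realizable; that is, no hyperbolic polynomial of degree d realizes it. -/

import Mathlib

open Polynomial Finset

/-- A real polynomial `P` of degree `d` defines the sign pattern `Σ_{m,n,q}`:
reading the coefficients from that of `x^d` down to the constant term, the first
`m` are positive, the next `n` are negative and the last `q` are positive
(in particular all `d+1` coefficients are nonzero), where `m + n + q = d + 1`. -/
def SignPatternMNQ (P : Polynomial ℝ) (d m n q : ℕ) : Prop :=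
  m + n + q = d + 1 ∧ 0 < m ∧ 0 < n ∧ 0 < q ∧
  (∀ k, k ≤ d → (d - k < m ∨ m + n ≤ d - k) → 0 < P.coeff k) ∧
  (∀ k, k ≤ d → (m ≤ d - k ∧ d - k < m + n) → P.coeff k < 0)

/-- The couple `(Σ_{m,n,q}, (u,v,w))` is realizable (in degree `d`): there is a
hyperbolic polynomial `P` of degree `d` defining the sign pattern `Σ_{m,n,q}`,
whose roots are exactly two positive numbers `β < α` together with `d - 2`
negative numbers `-γ i`, all moduli being distinct, such that exactly `u` of
the `γ i` are `< β`, exactly `v` lie in `(β, α)` and exactly `w` are `> α`. -/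
def RealizesCouple (d m n q u v w : ℕ) : Prop :=
  ∃ (P : Polynomial ℝ) (α β : ℝ) (γ : Fin (d - 2) → ℝ),
    P.natDegree = d ∧
    SignPatternMNQ P d m n q ∧
    0 < β ∧ β < α ∧
    StrictMono γ ∧ (∀ i, 0 < γ i) ∧ (∀ i, γ i ≠ β ∧ γ i ≠ α) ∧
    P.roots = (α ::ₘ β ::ₘ Multiset.map (fun i => -γ i) Finset.univ.val) ∧
    (Finset.univ.filter (fun i => γ i < β)).card = u ∧
    (Finset.univ.filter (fun i => β < γ i ∧ γ i < α)).card = v ∧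
    (Finset.univ.filter (fun i => α < γ i)).card = w

/-- Twice the second elementary symmetric function of the reciprocals, compared with
their sum. -/
lemma two_mul_sum_inv_le {ι : Type*} (s : Finset ι) (hs : s.Nonempty) (g : ι → ℝ)
    (hg : ∀ i ∈ s, 0 < g i) :
    2 * ((s.card : ℝ) - 1) * ∑ i ∈ s, (g i)⁻¹ ≤
        (∑ i ∈ s, g i) * ((∑ i ∈ s, (g i)⁻¹) ^ 2 - ∑ i ∈ s, (g i)⁻¹ ^ 2) ∧
      (s.card : ℝ) ^ 2 ≤ (∑ i ∈ s, g i) * ∑ i ∈ s, (g i)⁻¹ ∧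
      0 ≤ (∑ i ∈ s, (g i)⁻¹) ^ 2 - ∑ i ∈ s, (g i)⁻¹ ^ 2 := by
  induction hs using Finset.Nonempty.cons_induction with
  | singleton a =>
    have h := hg a (by simp)
    have : g a * (g a)⁻¹ = 1 := mul_inv_cancel₀ h.ne'
    simp [this]
  | cons a s ha hs ih =>
    obtain ⟨h1, h2, h3⟩ := ih fun i hi => hg i (by simp [hi])
    have hx : 0 < g a := hg a (by simp)
    have hf : 0 < ∑ i ∈ s, g i := Finset.sum_pos (fun i hi => hg i (by simp [hi])) hs
    have hF : 0 < ∑ i ∈ s, (g i)⁻¹ :=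
      Finset.sum_pos (fun i hi => inv_pos.2 (hg i (by simp [hi]))) hs
    have hM : (1 : ℝ) ≤ s.card := by exact_mod_cast hs.card_pos
    simp only [Finset.sum_cons, Finset.card_cons, Nat.cast_add, Nat.cast_one]
    generalize (∑ i ∈ s, g i) = f at *
    generalize (∑ i ∈ s, (g i)⁻¹) = F at *
    generalize (∑ i ∈ s, (g i)⁻¹ ^ 2) = Q at *
    generalize (s.card : ℝ) = M at *
    have hy : 0 < (g a)⁻¹ := inv_pos.2 hx
    have hxy : g a * (g a)⁻¹ = 1 := mul_inv_cancel₀ hx.ne'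
    generalize g a = x at *
    generalize x⁻¹ = y at *
    have hFy : 0 < F * y := mul_pos hF hy
    refine ⟨?_, ?_, by nlinarith⟩
    · have e : (x + f) * ((y + F) ^ 2 - (y ^ 2 + Q)) =
          x * (F ^ 2 - Q) + f * (F ^ 2 - Q) + 2 * (x * y) * F + 2 * y * (f * F) := by ring
      have h4 : M * y ≤ f * F * y := mul_le_mul_of_nonneg_right (by nlinarith) hy.le
      have h5 := mul_nonneg hx.le h3
      rw [e, hxy]
      nlinarith
    · have e : (x + f) * (y + F) = x * y + f * F + (x * F + f * y) := by ring
      have h6 : (2 * M) ^ 2 ≤ (x * F + f * y) ^ 2 := by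
        have : (x * F) * (f * y) = f * F := by linear_combination f * F * hxy
        nlinarith [sq_nonneg (x * F - f * y)]
      have h7 : 2 * M ≤ x * F + f * y := le_of_sq_le_sq h6 (by positivity)
      rw [e, hxy]
      nlinarith

lemma second_coeffs_incompatible_scalar (b x y z f q F Q : ℝ) (hb : 0 < b) (hb1 : b < 1)
    (hx : 1 < x) (hy : 1 < y) (hz : 1 < z) (hf : 0 < f) (hq : q ≤ f ^ 2)
    (hfF : 4 ≤ f * F) (hQ : 2 * F ≤ f * (F ^ 2 - Q))
    (h1 : (1 + b - (x + y + z + f)) ^ 2 < 1 + b ^ 2 + (x ^ 2 + y ^ 2 + z ^ 2 + q))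
    (h2 : (1 + b⁻¹ - (x⁻¹ + y⁻¹ + z⁻¹ + F)) ^ 2 <
      1 + b⁻¹ ^ 2 + (x⁻¹ ^ 2 + y⁻¹ ^ 2 + z⁻¹ ^ 2 + Q)) : False := by
  have hx' : x⁻¹ < 1 := inv_lt_one_of_one_lt₀ hx
  have hy' : y⁻¹ < 1 := inv_lt_one_of_one_lt₀ hy
  have hz' : z⁻¹ < 1 := inv_lt_one_of_one_lt₀ hz
  have hx0 : 0 < x⁻¹ := inv_pos.2 (by linarith)
  have hy0 : 0 < y⁻¹ := inv_pos.2 (by linarith)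
  have hz0 : 0 < z⁻¹ := inv_pos.2 (by linarith)
  have hA : f * (x + y + z - 1 - b) < 2 * b := by
    nlinarith [mul_pos (sub_pos.2 hx) (sub_pos.2 hy), mul_pos (sub_pos.2 hx) (sub_pos.2 hz),
      mul_pos (sub_pos.2 hy) (sub_pos.2 hz),
      mul_pos (sub_pos.2 hb1) (by linarith : 0 < x + y + z - 3)]
  have hAB : 9 ≤ (x + y + z) * (x⁻¹ + y⁻¹ + z⁻¹) := by
    have := (two_mul_sum_inv_le (Finset.univ : Finset (Fin 3)) (by simp) ![x, y, z] (by
      intro i _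
      fin_cases i <;> simp <;> linarith)).2.1
    simp [Fin.sum_univ_three] at this
    linarith
  have hbb : b * b⁻¹ = 1 := mul_inv_cancel₀ hb.ne'
  have hkf : f * f⁻¹ = 1 := mul_inv_cancel₀ hf.ne'
  have hk : 0 < f⁻¹ := inv_pos.2 hf
  have hbk : x + y + z - 1 - b < 2 * b * f⁻¹ := by
    have := mul_lt_mul_of_pos_right hA hk
    linear_combination this - (x + y + z - 1 - b) * hkf
  have hF : 4 * f⁻¹ ≤ F := by
    have := mul_le_mul_of_nonneg_right hfF hk.le
    linear_combination this + F * hkf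
  have hFQ : 2 * F * f⁻¹ ≤ F ^ 2 - Q := by
    have := mul_le_mul_of_nonneg_right hQ hk.le
    linear_combination this + (F ^ 2 - Q) * hkf
  have hB2 : 2 * (x⁻¹ + y⁻¹ + z⁻¹) - 3 ≤ x⁻¹ * y⁻¹ + x⁻¹ * z⁻¹ + y⁻¹ * z⁻¹ := by
    nlinarith [mul_pos (sub_pos.2 hx') (sub_pos.2 hy'), mul_pos (sub_pos.2 hx') (sub_pos.2 hz'),
      mul_pos (sub_pos.2 hy') (sub_pos.2 hz')]
  have hA3 : 3 < x + y + z := by linarith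
  have hB3 : x⁻¹ + y⁻¹ + z⁻¹ < 3 := by linarith
  have hB0 : 0 < x⁻¹ + y⁻¹ + z⁻¹ := by linarith
  have e : (F ^ 2 - Q) / 2 + F * (x⁻¹ + y⁻¹ + z⁻¹ - 1 - b⁻¹) +
      (x⁻¹ * y⁻¹ + x⁻¹ * z⁻¹ + y⁻¹ * z⁻¹) - (1 + b⁻¹) * (x⁻¹ + y⁻¹ + z⁻¹) + b⁻¹ < 0 := by
    linear_combination h2 / 2
  generalize x⁻¹ * y⁻¹ + x⁻¹ * z⁻¹ + y⁻¹ * z⁻¹ = B2 at *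
  generalize x⁻¹ + y⁻¹ + z⁻¹ = B at *
  generalize x + y + z = A at *
  generalize f⁻¹ = k at *
  have e2 : b * ((F ^ 2 - Q) / 2) + F * (b * B - b - 1) + b * B2 - (1 + b) * B + 1 < 0 := by
    have := mul_neg_of_pos_of_neg hb e
    linear_combination this + (F + B - 1) * hbb
  have hcoef : 6 / 5 ≤ B - 3 / 2 + (A - 3) / 2 := by
    have : (21 / 5 : ℝ) ≤ B + A / 2 := by
      refine le_of_sq_le_sq ?_ (by linarith)
      linarith [sq_nonneg (B - A / 2)]
    linarith
  have hF0 : 0 < F := by linarith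
  have hbF : 2 ≤ b * F := by linarith [mul_le_mul_of_nonneg_left hF hb.le]
  have h3 : b * (F * k) ≤ b * ((F ^ 2 - Q) / 2) := mul_le_mul_of_nonneg_left (by linarith) hb.le
  have h4 : F * (A - 1 - b) ≤ F * (2 * b * k) := mul_le_mul_of_nonneg_left hbk.le hF0.le
  have h5 : b * (A - 3) ≤ A - 3 := mul_le_of_le_one_left (by linarith) hb1.le
  have h6 : F * (b * (A - 3)) ≤ F * (A - 3) := mul_le_mul_of_nonneg_left h5 hF0.le
  have h7 : b * F * (6 / 5) ≤ b * F * (B - 3 / 2 + (A - 3) / 2) :=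
    mul_le_mul_of_nonneg_left hcoef (by linarith)
  have h8 : b * (2 * B - 3) ≤ b * B2 := mul_le_mul_of_nonneg_left hB2 hb.le
  have h9 : (1 - b) * B ≤ (1 - b) * 3 := mul_le_mul_of_nonneg_left hB3.le (by linarith)
  linarith

lemma second_coeffs_incompatible_of_one {ι : Type*} (s : Finset ι) (g : ι → ℝ) (b : ℝ)
    (hs : 5 ≤ s.card) (hg : ∀ i ∈ s, 0 < g i) (hb : 0 < b) (hb1 : b < 1)
    (h3 : 3 ≤ (s.filter fun i => 1 < g i).card)
    (h1 : (1 + b - ∑ i ∈ s, g i) ^ 2 < 1 + b ^ 2 + ∑ i ∈ s, g i ^ 2)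
    (h2 : (1 + b⁻¹ - ∑ i ∈ s, (g i)⁻¹) ^ 2 < 1 + b⁻¹ ^ 2 + ∑ i ∈ s, (g i)⁻¹ ^ 2) :
    False := by
  classical
  obtain ⟨t, ht, hc⟩ := Finset.exists_subset_card_eq h3
  have hts : t ⊆ s := ht.trans (Finset.filter_subset _ _)
  have hlarge : ∀ i ∈ t, 1 < g i := fun i hi => (Finset.mem_filter.1 (ht hi)).2
  obtain ⟨x, y, z, hxy, hxz, hyz, rfl⟩ := Finset.card_eq_three.1 hc
  have hcard : 2 ≤ (s \ {x, y, z}).card := by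
    rw [Finset.card_sdiff_of_subset hts, hc]
    omega
  have hne : (s \ {x, y, z}).Nonempty := Finset.card_pos.1 (by omega)
  have hpos : ∀ i ∈ s \ {x, y, z}, 0 < g i := fun i hi => hg i (Finset.mem_sdiff.1 hi).1
  have hsplit : ∀ h : ι → ℝ, ∑ i ∈ s, h i = h x + h y + h z + ∑ i ∈ s \ {x, y, z}, h i := by
    intro h
    rw [← Finset.sum_sdiff hts, Finset.sum_insert (by simp [hxy, hxz]),
      Finset.sum_pair hyz]
    ring
  obtain ⟨hQ, hfF, -⟩ := two_mul_sum_inv_le _ hne g hpos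
  have hcard' : (2 : ℝ) ≤ ((s \ {x, y, z}).card : ℝ) := by exact_mod_cast hcard
  have hF : 0 < ∑ i ∈ s \ {x, y, z}, (g i)⁻¹ :=
    Finset.sum_pos (fun i hi => inv_pos.2 (hpos i hi)) hne
  refine second_coeffs_incompatible_scalar b (g x) (g y) (g z) (∑ i ∈ s \ {x, y, z}, g i)
    (∑ i ∈ s \ {x, y, z}, g i ^ 2) (∑ i ∈ s \ {x, y, z}, (g i)⁻¹)
    (∑ i ∈ s \ {x, y, z}, (g i)⁻¹ ^ 2) hb hb1 (hlarge _ (by simp)) (hlarge _ (by simp))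
    (hlarge _ (by simp)) (Finset.sum_pos hpos hne) ?_ (by nlinarith) (by nlinarith) ?_ ?_
  · exact Finset.sum_sq_le_sq_sum_of_nonneg fun i hi => (hpos i hi).le
  · simpa only [hsplit] using h1
  · simpa only [hsplit] using h2

lemma second_coeffs_incompatible {ι : Type*} (s : Finset ι) (g : ι → ℝ) (a b : ℝ)
    (hs : 5 ≤ s.card) (hg : ∀ i ∈ s, 0 < g i) (hb : 0 < b) (hba : b < a)
    (h3 : 3 ≤ (s.filter fun i => a < g i).card)
    (h1 : (a + b - ∑ i ∈ s, g i) ^ 2 < a ^ 2 + b ^ 2 + ∑ i ∈ s, g i ^ 2)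
    (h2 : (a⁻¹ + b⁻¹ - ∑ i ∈ s, (g i)⁻¹) ^ 2 <
      a⁻¹ ^ 2 + b⁻¹ ^ 2 + ∑ i ∈ s, (g i)⁻¹ ^ 2) :
    False := by
  have ha : 0 < a := hb.trans hba
  refine second_coeffs_incompatible_of_one s (fun i => g i / a) (b / a) hs
    (fun i hi => div_pos (hg i hi) ha) (div_pos hb ha) ((div_lt_one ha).2 hba) ?_ ?_ ?_
  · simpa only [one_lt_div ha] using h3
  · have := mul_lt_mul_of_pos_right h1 (pow_pos (inv_pos.2 ha) 2)
    have haa : a * a⁻¹ = 1 := mul_inv_cancel₀ ha.ne'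
    simp only [div_eq_mul_inv, mul_pow, ← Finset.sum_mul]
    rwa [← mul_pow, sub_mul, add_mul, haa, add_mul, add_mul, ← mul_pow a, haa, one_pow] at this
  · have := mul_lt_mul_of_pos_right h2 (pow_pos ha 2)
    have haa : a⁻¹ * a = 1 := inv_mul_cancel₀ ha.ne'
    simp only [div_eq_mul_inv, mul_inv, inv_inv, mul_pow, ← Finset.sum_mul]
    rwa [← mul_pow, sub_mul, add_mul, haa, add_mul, add_mul, ← mul_pow a⁻¹, haa, one_pow] at this

/-- The first three coefficients of a product of polynomials `1 - r X`. -/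
lemma coeff_prod_one_sub_C_mul_X (s : Multiset ℝ) :
    (s.map fun r => (1 - C r * X : ℝ[X])).prod.coeff 0 = 1 ∧
      (s.map fun r => (1 - C r * X : ℝ[X])).prod.coeff 1 = -s.sum ∧
      2 * (s.map fun r => (1 - C r * X : ℝ[X])).prod.coeff 2 =
        s.sum ^ 2 - (s.map fun r => r ^ 2).sum := by
  induction s using Multiset.induction with
  | empty => simp [coeff_one]
  | cons a s ih =>
    obtain ⟨h0, h1, h2⟩ := ih
    simp only [Multiset.map_cons, Multiset.prod_cons, Multiset.sum_cons, sub_mul, one_mul,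
      mul_assoc, coeff_sub, coeff_C_mul, coeff_X_mul_zero, h0]
    rw [coeff_X_mul _ 0, coeff_X_mul _ 1, h0, h1, mul_sub, h2]
    refine ⟨by ring, by ring, by ring⟩

lemma two_mul_coeff_prod_X_sub_C (s : Multiset ℝ) (hs : 2 ≤ s.card) :
    2 * (s.map fun r => (X - C r : ℝ[X])).prod.coeff (s.card - 2) =
      s.sum ^ 2 - (s.map fun r => r ^ 2).sum := by
  have hrev : (s.map fun r => (X - C r : ℝ[X])).prod.reverse =
      (s.map fun r => (1 - C r * X : ℝ[X])).prod := by
    clear hs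
    induction s using Multiset.induction with
    | empty => simpa using reverse_C (1 : ℝ)
    | cons a s ih =>
      have : (X - C a : ℝ[X]).reverse = 1 - C a * X := by
        ext k
        rw [coeff_reverse, natDegree_X_sub_C]
        rcases k with _ | _ | k
        · rw [revAt_le zero_le_one]
          simp [coeff_C]
        · rw [revAt_le le_rfl]
          simp [coeff_one]
        · rw [revAt_eq_self_of_lt (by omega)]
          simp [coeff_X, coeff_one]
      simp only [Multiset.map_cons, Multiset.prod_cons, reverse_mul_of_domain, ih, this]
  have hdeg := natDegree_multiset_prod_X_sub_C_eq_card s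
  rw [← (coeff_prod_one_sub_C_mul_X s).2.2, ← hrev, coeff_reverse, hdeg, revAt_le hs]

lemma two_mul_coeff_two_prod_X_sub_C (s : Multiset ℝ) (hs : ∀ r ∈ s, r ≠ 0) :
    2 * (s.map fun r => (X - C r : ℝ[X])).prod.coeff 2 =
      (s.map fun r => (X - C r : ℝ[X])).prod.coeff 0 *
        ((s.map fun r => r⁻¹).sum ^ 2 - (s.map fun r => r⁻¹ ^ 2).sum) := by
  have hprod : (s.map fun r => (X - C r : ℝ[X])).prod =
      C (s.map fun r => -r).prod *
        ((s.map fun r => r⁻¹).map fun r => (1 - C r * X : ℝ[X])).prod := by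
    rw [Multiset.map_map, map_multiset_prod, Multiset.map_map, ← Multiset.prod_map_mul]
    refine congrArg _ (Multiset.map_congr rfl fun r hr => ?_)
    have h : (C r * C r⁻¹ : ℝ[X]) = 1 := by rw [← C_mul, mul_inv_cancel₀ (hs r hr), C_1]
    simp only [Function.comp_apply, C_neg]
    linear_combination -X * h
  obtain ⟨h0, -, h2⟩ := coeff_prod_one_sub_C_mul_X (s.map fun r => r⁻¹)
  rw [hprod, coeff_C_mul, coeff_C_mul, h0, mul_one, mul_left_comm, h2, Multiset.map_map]
  rfl

/-- Theorem 2 (2): for `n ≥ 4` and `d = n + 3`, every couple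
`(Σ_{2,n,2}, (u,v,w))` with `u + v + w = n + 1` and `u ≥ 3` or `w ≥ 3`
is not realizable. -/
theorem stmt4 (n u v w : ℕ) (hn : 4 ≤ n) (huvw : u + v + w = n + 1)
    (huw : 3 ≤ u ∨ 3 ≤ w) :
    ¬ RealizesCouple (n + 3) 2 n 2 u v w := by
  rintro ⟨P, α, β, γ, hdeg, ⟨-, -, -, -, hplus, hminus⟩, hβ, hβα, -, hγ, -, hroots, hu, -, hw⟩
  have hα : 0 < α := hβ.trans hβα
  have hcard : P.roots.card = n + 3 := by
    rw [hroots]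
    simp
  have hlead : 0 < P.leadingCoeff := by
    rw [leadingCoeff, hdeg]
    exact hplus _ le_rfl (by omega)
  have hP : C P.leadingCoeff * (P.roots.map fun r => X - C r).prod = P :=
    C_leadingCoeff_mul_prod_multiset_X_sub_C (by rw [hcard, hdeg])
  have hne : ∀ r ∈ P.roots, r ≠ 0 := by
    rw [hroots]
    simp only [Multiset.mem_cons, Multiset.mem_map]
    rintro r (rfl | rfl | ⟨i, -, rfl⟩)
    · exact hα.ne'
    · exact hβ.ne'
    · exact neg_ne_zero.2 (hγ i).ne'
  have hhigh := two_mul_coeff_prod_X_sub_C P.roots (by omega)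
  have hlow := two_mul_coeff_two_prod_X_sub_C P.roots hne
  have hc0 := hplus 0 (by omega) (by omega)
  have hc2 := hminus 2 (by omega) (by omega)
  have hcd := hminus (n + 1) (by omega) (by omega)
  rw [← hP, coeff_C_mul] at hc0 hc2 hcd
  have hc0' := pos_of_mul_pos_right hc0 hlead.le
  have hc2' := neg_of_mul_neg_right hc2 hlead.le
  have hcd' := neg_of_mul_neg_right hcd hlead.le
  rw [hcard, show n + 3 - 2 = n + 1 by omega] at hhigh
  have h1 : P.roots.sum ^ 2 - (P.roots.map fun r => r ^ 2).sum < 0 := by linarith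
  have h2 : (P.roots.map fun r => r⁻¹).sum ^ 2 - (P.roots.map fun r => r⁻¹ ^ 2).sum < 0 :=
    neg_of_mul_neg_right (by linarith) hc0'.le
  have hsum : ∀ h : ℝ → ℝ, (P.roots.map h).sum = h α + h β + ∑ i, h (-γ i) := by
    intro h
    simp only [hroots, Multiset.map_cons, Multiset.sum_cons, Multiset.map_map, add_assoc]
    rfl
  have hsum' : P.roots.sum = α + β + ∑ i, -γ i := by
    simpa using hsum id
  rw [hsum', hsum] at h1
  rw [hsum, hsum] at h2
  simp only [inv_neg, neg_sq, Finset.sum_neg_distrib, ← sub_eq_add_neg] at h1 h2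
  have hcards : 5 ≤ (Finset.univ : Finset (Fin (n + 3 - 2))).card := by
    rw [Finset.card_univ, Fintype.card_fin]
    omega
  rcases huw with h | h
  · refine second_coeffs_incompatible Finset.univ (fun i => (γ i)⁻¹) β⁻¹ α⁻¹ hcards
      (fun i _ => inv_pos.2 (hγ i)) (inv_pos.2 hα) (inv_strictAnti₀ hβ hβα) ?_ ?_ ?_
    · have : ∀ i, β⁻¹ < (γ i)⁻¹ ↔ γ i < β := fun i => inv_lt_inv₀ hβ (hγ i)
      simp only [this, hu]
      exact h
    · rw [add_comm β⁻¹, add_comm (β⁻¹ ^ 2)]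
      linarith
    · simp only [inv_inv]
      rw [add_comm β, add_comm (β ^ 2)]
      linarith
  · exact second_coeffs_incompatible Finset.univ γ α β hcards (fun i _ => hγ i) hβ hβα
      (by rw [hw]; exact h) (by linarith) (by linarith)
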